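/- Let σ : ℝ → ℝ be Lipschitz continuous and not equal to any polynomial, let Ω ⊂ ℝⁿ be compact, let r ≤ n, let W_o ∈ ℝ^{n×r} have rank r and b_o ∈ ℝʳ, and let f : Ω → ℝʳ be continuous. Then for every ε > 0 there exist N ∈ ℕ, a step size h > 0, weights J_j ∈ ℝ^{2n×2n} skew-symmetric, W_j ∈ ℝ^{2n×2n}, b_j ∈ ℝ^{2n}, η_j ∈ ℝ^{2n} for j = 0,…,N−1, and a map Q : Ω → ℝⁿ such that for every ξ ∈ Ω there is an HDNN trajectory (p_j, q_j)_{j=0}^{N} with these weights, initial condition (p_0, q_0) = (ξ, 0ₙ), and q_N = Q(ξ), and such that sup_{ξ ∈ Ω} ‖f(ξ) − (W_oᵀ Q(ξ) + b_o)‖ ≤ ε. -/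

import Mathlib

open Matrix

/-- Euclidean norm of a finitely-indexed real vector. -/
noncomputable def euclNorm {m : Type*} [Fintype m] (v : m → ℝ) : ℝ :=
  Real.sqrt (∑ i, v i ^ 2)

/-- Entrywise application of a scalar function to a vector. -/
def entApp {m : Type*} (σ : ℝ → ℝ) (v : m → ℝ) : m → ℝ := fun i => σ (v i)

/-- `(p_j, q_j)_{j=0}^{N}` is an HDNN trajectory (semi-implicit Euler recursion)
with step size `h`, activation `σ`, and weights `J_j, W_j, b_j, η_j`:
`(p_{j+1}; q_{j+1}) = (p_j; q_j) + h • J_j (W_jᵀ σ(W_j (p_{j+1}; q_j) + b_j) + η_j)`. -/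
def IsHDNNTraj (n N : ℕ) (h : ℝ) (σ : ℝ → ℝ)
    (J W : ℕ → Matrix (Fin n ⊕ Fin n) (Fin n ⊕ Fin n) ℝ)
    (b η : ℕ → ((Fin n ⊕ Fin n) → ℝ))
    (p q : ℕ → (Fin n → ℝ)) : Prop :=
  ∀ j < N,
    Sum.elim (p (j + 1)) (q (j + 1)) =
      Sum.elim (p j) (q j) +
        h • (J j).mulVec
          ((W j)ᵀ.mulVec (entApp σ ((W j).mulVec (Sum.elim (p (j + 1)) (q j)) + b j)) + η j)

open MeasureTheory Filter Topology
open scoped ContDiff Convolution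

theorem exists_polynomial_of_iteratedDeriv_eq_zero {g : ℝ → ℝ} (hg : ContDiff ℝ ∞ g) {k : ℕ}
    (h : ∀ x, iteratedDeriv k g x = 0) :
    ∃ P : Polynomial ℝ, P.degree < k ∧ ∀ x, g x = P.eval x := by
  obtain _ | k := k
  · exact ⟨0, by simp, by simpa using h⟩
  refine ⟨∑ i ∈ Finset.range (k + 1),
    Polynomial.C (iteratedDeriv i g 0 / i.factorial) * Polynomial.X ^ i, ?_, fun x => ?_⟩
  · rw [← Polynomial.mem_degreeLT]
    refine Submodule.sum_mem _ fun i hi => Polynomial.mem_degreeLT.2 ?_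
    refine (Polynomial.degree_C_mul_X_pow_le _ _).trans_lt ?_
    exact_mod_cast Finset.mem_range.1 hi
  · have hgk (m : ℕ) : ContDiff ℝ m g := hg.of_le (by exact_mod_cast le_top)
    simp only [Polynomial.eval_finsetSum, Polynomial.eval_mul, Polynomial.eval_C,
      Polynomial.eval_pow, Polynomial.eval_X]
    rcases eq_or_ne 0 x with rfl | hx
    · rw [Finset.sum_eq_single 0] <;> simp +contextual
    · obtain ⟨y, -, hy⟩ := taylor_mean_remainder_lagrange_iteratedDeriv (n := k) hx
        (by exact_mod_cast (hgk (k + 1)).contDiffOn)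
      rw [h, zero_mul, zero_div, sub_eq_zero, taylor_within_apply] at hy
      rw [hy]
      refine Finset.sum_congr rfl fun i _ => ?_
      rw [iteratedDerivWithin_eq_iteratedDeriv (uniqueDiffOn_uIcc hx) (hgk i).contDiffAt
        Set.left_mem_uIcc, smul_eq_mul, sub_zero]
      ring

theorem exists_polynomial_of_tendsto {ι : Type*} {l : Filter ι} [l.NeBot] {g : ι → ℝ → ℝ}
    {f : ℝ → ℝ} {k : ℕ} (hg : ∀ i, ∃ P : Polynomial ℝ, P.degree < k ∧ ∀ x, g i x = P.eval x)
    (hf : ∀ x, Tendsto (fun i => g i x) l (𝓝 (f x))) :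
    ∃ P : Polynomial ℝ, ∀ x, f x = P.eval x := by
  have hinj : Set.InjOn (fun i : ℕ => (i : ℝ)) (Finset.range k) := Nat.cast_injective.injOn
  refine ⟨Lagrange.interpolate (Finset.range k) (fun i : ℕ => (i : ℝ)) fun i => f i, fun x => ?_⟩
  refine tendsto_nhds_unique (hf x) ?_
  have hgi (i) : g i x = ∑ j ∈ Finset.range k,
      g i j * (Lagrange.basis (Finset.range k) (fun i : ℕ => (i : ℝ)) j).eval x := by
    obtain ⟨P, hP, h⟩ := hg i
    have hP' := Lagrange.eq_interpolate (f := P) hinj (by simpa using hP)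
    conv_lhs => rw [h, hP', Lagrange.interpolate_apply]
    simp [Polynomial.eval_finsetSum, h]
  simp only [hgi, Lagrange.interpolate_apply, Polynomial.eval_finsetSum, Polynomial.eval_mul,
    Polynomial.eval_C]
  exact tendsto_finsetSum _ fun j _ => (hf j).mul_const _

theorem contDiff_normed_convolution (φ : ContDiffBump (0 : ℝ)) {σ : ℝ → ℝ} (hσ : Continuous σ) :
    ContDiff ℝ ∞ (φ.normed volume ⋆[ContinuousLinearMap.lsmul ℝ ℝ, volume] σ) :=
  φ.hasCompactSupport_normed.contDiff_convolution_left _ φ.contDiff_normed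
    hσ.locallyIntegrable

theorem exists_iteratedDeriv_normed_convolution_ne_zero {σ : ℝ → ℝ} (hσ : Continuous σ)
    (hpoly : ¬ ∃ P : Polynomial ℝ, ∀ x : ℝ, σ x = P.eval x) (k : ℕ) :
    ∃ (φ : ContDiffBump (0 : ℝ)) (b : ℝ),
      iteratedDeriv k (φ.normed volume ⋆[ContinuousLinearMap.lsmul ℝ ℝ, volume] σ) b ≠ 0 := by
  by_contra! h
  let φ (m : ℕ) : ContDiffBump (0 : ℝ) :=
    ⟨1 / (m + 1) / 2, 1 / (m + 1), by positivity, half_lt_self (by positivity)⟩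
  refine hpoly (exists_polynomial_of_tendsto (l := atTop) (k := k)
    (fun m => exists_polynomial_of_iteratedDeriv_eq_zero (contDiff_normed_convolution (φ m) hσ)
      (h (φ m)))
    fun x => ContDiffBump.convolution_tendsto_right_of_continuous ?_ hσ x)
  exact tendsto_one_div_add_atTop_nhds_zero_nat

section Functional

variable {X : Type*} [TopologicalSpace X] [CompactSpace X] {L : C(X, ℝ) →L[ℝ] ℝ} {u : C(X, ℝ)}

theorem map_normed_convolution_comp_eq_zero {σ g : C(ℝ, ℝ)}
    (hL : ∀ a b : ℝ, L (σ.comp (a • u + .const X b)) = 0) (φ : ContDiffBump (0 : ℝ))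
    (hg : ⇑g = φ.normed volume ⋆[ContinuousLinearMap.lsmul ℝ ℝ, volume] σ) (a b : ℝ) :
    L (g.comp (a • u + .const X b)) = 0 := by
  let Γ : C(ℝ, C(X, ℝ)) := ContinuousMap.curry ⟨fun p => σ (a * u p.2 + b - p.1), by fun_prop⟩
  have hΓ : Integrable (fun t => φ.normed volume t • Γ t) :=
    (φ.continuous_normed.smul Γ.continuous).integrable_of_hasCompactSupport
      φ.hasCompactSupport_normed.smul_right
  have hgΓ : g.comp (a • u + .const X b) = ∫ t, φ.normed volume t • Γ t := by
    ext x
    have := (ContinuousMap.evalCLM ℝ x).integral_comp_comm hΓ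
    simp only [ContinuousMap.evalCLM_apply] at this
    rw [← this]
    simp [hg, convolution, Γ]
  rw [hgΓ, ← L.integral_comp_comm hΓ]
  have hLΓ (t) : L (Γ t) = 0 := by
    rw [← hL a (b - t)]
    congr 1
    ext x
    simp [Γ, add_sub_assoc]
  simp [hLΓ]

theorem map_pow_mul_deriv_comp_eq_zero {g g' : C(ℝ, ℝ)} (hg : ∀ x, HasDerivAt g (g' x) x)
    {k : ℕ} (hL : ∀ a b : ℝ, L (u ^ k * g.comp (a • u + .const X b)) = 0) (a b : ℝ) :
    L (u ^ (k + 1) * g'.comp (a • u + .const X b)) = 0 := by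
  let Γ : C(ℝ, C(X, ℝ)) :=
    ContinuousMap.curry ⟨fun p => u p.2 ^ (k + 1) * g' (p.1 * u p.2 + b), by fun_prop⟩
  have hΓ (s : ℝ) : IntervalIntegrable Γ volume 0 s := Γ.continuous.intervalIntegrable _ _
  have hint (s : ℝ) : ∫ t in (0 : ℝ)..s, Γ t =
      u ^ k * g.comp (s • u + .const X b) - u ^ k * g.comp ((0 : ℝ) • u + .const X b) := by
    ext x
    have := (ContinuousMap.evalCLM ℝ x).intervalIntegral_comp_comm (hΓ s)
    simp only [ContinuousMap.evalCLM_apply] at this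
    rw [← this, intervalIntegral.integral_eq_sub_of_hasDerivAt
      (f := fun t => u x ^ k * g (t * u x + b))]
    · simp
    · intro t _
      have h1 : HasDerivAt (fun t : ℝ => t * u x + b) (u x) t := by
        simpa using ((hasDerivAt_id t).mul_const (u x)).add_const b
      refine (((hg _).comp t h1).const_mul (u x ^ k)).congr_deriv ?_
      simp [Γ, pow_succ, mul_comm, mul_assoc, mul_left_comm]
    · exact Continuous.intervalIntegrable (by fun_prop) _ _
  have hLint (s : ℝ) : ∫ t in (0 : ℝ)..s, L (Γ t) = 0 := by
    rw [L.intervalIntegral_comp_comm (hΓ s), hint, map_sub, hL, hL, sub_zero]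
  have hd := (L.continuous.comp Γ.continuous).integral_hasStrictDerivAt 0 a
  have hd' := hd.hasDerivAt.unique
    ((hasDerivAt_const a (0 : ℝ)).congr_of_eventuallyEq (.of_forall hLint))
  exact hd'

theorem map_pow_mul_iteratedDeriv_comp_eq_zero {g : ℝ → ℝ} (hg : ContDiff ℝ ∞ g)
    (hL : ∀ a b : ℝ, L ((⟨g, hg.continuous⟩ : C(ℝ, ℝ)).comp (a • u + .const X b)) = 0)
    (k : ℕ) (a b : ℝ) :
    L (u ^ k * (⟨iteratedDeriv k g, hg.continuous_iteratedDeriv k (by exact_mod_cast le_top)⟩ :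
      C(ℝ, ℝ)).comp (a • u + .const X b)) = 0 := by
  induction k generalizing a b with
  | zero => simpa using hL a b
  | succ k ih =>
    refine map_pow_mul_deriv_comp_eq_zero (fun x => ?_) ih a b
    simp only [ContinuousMap.coe_mk, iteratedDeriv_succ]
    exact (hg.differentiable_iteratedDeriv k (by exact_mod_cast WithTop.coe_lt_top _) x).hasDerivAt

theorem map_pow_eq_zero {σ : C(ℝ, ℝ)}
    (hpoly : ¬ ∃ P : Polynomial ℝ, ∀ x : ℝ, σ x = P.eval x)
    (hL : ∀ a b : ℝ, L (σ.comp (a • u + .const X b)) = 0) (k : ℕ) : L (u ^ k) = 0 := by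
  obtain ⟨φ, b, hb⟩ := exists_iteratedDeriv_normed_convolution_ne_zero σ.continuous hpoly k
  have hg := contDiff_normed_convolution φ σ.continuous
  have h := map_pow_mul_iteratedDeriv_comp_eq_zero hg
    (map_normed_convolution_comp_eq_zero hL φ rfl) k 0 b
  refine (smul_eq_zero.1 ((map_smul L _ _).symm.trans (Eq.trans ?_ h))).resolve_left hb
  congr 1
  ext x
  simp [mul_comm]

theorem map_exp_eq_zero_of_map_pow_eq_zero (hL : ∀ k, L (u ^ k) = 0) :
    L (NormedSpace.exp u) = 0 := by
  have h := (NormedSpace.exp_series_hasSum_exp' (𝕂 := ℝ) u).mapL L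
  simp only [map_smul, hL, smul_zero] at h
  exact h.unique hasSum_zero

end Functional

theorem Submodule.dense_of_forall_dual_eq_zero {E : Type*} [NormedAddCommGroup E]
    [NormedSpace ℝ E] (V : Submodule ℝ E)
    (h : ∀ L : E →L[ℝ] ℝ, (∀ v ∈ V, L v = 0) → L = 0) : Dense (V : Set E) := by
  by_contra hV
  obtain ⟨x, hx⟩ := not_forall.1 hV
  obtain ⟨L, c, hLx, hL⟩ := geometric_hahn_banach_point_closed
    V.topologicalClosure.convex V.isClosed_topologicalClosure hx
  have h0 : c < 0 := by simpa using hL 0 (zero_mem _)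
  have hL0 : L = 0 := h L fun v hv => by
    by_contra hne
    have := hL ((c / L v) • v) (V.le_topologicalClosure (V.smul_mem _ hv))
    rw [map_smul, smul_eq_mul, div_mul_cancel₀ _ hne] at this
    exact this.false
  simp only [hL0, _root_.zero_apply] at hLx
  exact hLx.not_gt h0

/-- **Leshno–Lin–Pinkus–Schocken theorem**: if `σ` is continuous and not a polynomial, then the span
of the ridge functions `ξ ↦ σ (w ⬝ᵥ ξ + b)` is uniformly dense on compact sets. -/
theorem exists_mem_span_ridge_approx {ι : Type*} [Fintype ι] {σ : ℝ → ℝ} (hσ : Continuous σ)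
    (hpoly : ¬ ∃ P : Polynomial ℝ, ∀ x : ℝ, σ x = P.eval x) {Ω : Set (ι → ℝ)} (hΩ : IsCompact Ω)
    {f : (ι → ℝ) → ℝ} (hf : ContinuousOn f Ω) {ε : ℝ} (hε : 0 < ε) :
    ∃ G ∈ Submodule.span ℝ (Set.range fun (wb : (ι → ℝ) × ℝ) ξ => σ (wb.1 ⬝ᵥ ξ + wb.2)),
      ∀ ξ ∈ Ω, |f ξ - G ξ| < ε := by
  have := isCompact_iff_compactSpace.1 hΩ
  set T := Submodule.span ℝ (Set.range fun (wb : (ι → ℝ) × ℝ) ξ => σ (wb.1 ⬝ᵥ ξ + wb.2))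
  let V : Submodule ℝ C(Ω, ℝ) := (T.map (LinearMap.funLeft ℝ ℝ ((↑) : Ω → ι → ℝ))).comap
    (ContinuousMap.coeFnLinearMap ℝ)
  let u (w : ι → ℝ) : C(Ω, ℝ) := ⟨fun x => w ⬝ᵥ x, by fun_prop⟩
  have hexp (w) (x : Ω) : NormedSpace.exp (u w) x = Real.exp (w ⬝ᵥ x) := by
    have := NormedSpace.map_exp (ContinuousMap.evalAlgHom ℝ ℝ x)
      (ContinuousMap.evalCLM ℝ x).continuous (u w)
    rw [← Real.exp_eq_exp_ℝ] at this
    exact this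
  have hV : Dense (V : Set C(Ω, ℝ)) := by
    refine V.dense_of_forall_dual_eq_zero fun L hL => ?_
    let M : Submonoid C(Ω, ℝ) :=
      { carrier := Set.range fun w => NormedSpace.exp (u w)
        one_mem' := ⟨0, by ext x; simp [hexp]⟩
        mul_mem' := by
          rintro _ _ ⟨w, rfl⟩ ⟨v, rfl⟩
          exact ⟨w + v, by ext x; simp [hexp, add_dotProduct, Real.exp_add]⟩ }
    have hLM : ∀ v ∈ M, L v = 0 := by
      rintro _ ⟨w, rfl⟩
      refine map_exp_eq_zero_of_map_pow_eq_zero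
        (map_pow_eq_zero (σ := ⟨σ, hσ⟩) hpoly fun a b => hL _ ?_)
      exact ⟨_, Submodule.subset_span ⟨(a • w, b), rfl⟩, by ext x; simp [LinearMap.funLeft, u]⟩
    have hA : (Algebra.adjoin ℝ (M : Set C(Ω, ℝ))).topologicalClosure = ⊤ := by
      refine ContinuousMap.subalgebra_topologicalClosure_eq_top_of_separatesPoints _
        fun x y hxy => ?_
      refine ⟨_, ⟨_, Algebra.subset_adjoin ⟨(x - y : ι → ℝ), rfl⟩, rfl⟩, fun h => hxy ?_⟩
      simp only [hexp, Real.exp_eq_exp] at h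
      rw [← sub_eq_zero, ← dotProduct_sub, dotProduct_self_eq_zero, sub_eq_zero] at h
      exact Subtype.ext h
    have hker : (Algebra.adjoin ℝ (M : Set C(Ω, ℝ)) : Set C(Ω, ℝ)) ⊆ {v | L v = 0} := by
      intro v hv
      rw [SetLike.mem_coe, ← Subalgebra.mem_toSubmodule, Algebra.adjoin_eq_span,
        Submonoid.closure_eq] at hv
      exact (Submodule.span_le (p := LinearMap.ker L.toLinearMap)).2 hLM hv
    ext1 v
    have hv : v ∈ (Algebra.adjoin ℝ (M : Set C(Ω, ℝ))).topologicalClosure := hA ▸ Algebra.mem_top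
    exact closure_minimal hker (isClosed_eq L.continuous continuous_const) hv
  obtain ⟨g, ⟨G, hG, hGg⟩, hfg⟩ := hV.exists_dist_lt (⟨Ω.domRestrict f, hf.domRestrict⟩ : C(Ω, ℝ)) hε
  refine ⟨G, hG, fun ξ hξ => ?_⟩
  have h1 := (ContinuousMap.dist_lt_iff hε).1 hfg ⟨ξ, hξ⟩
  have h2 := congrFun hGg ⟨ξ, hξ⟩
  simp only [LinearMap.funLeft_apply] at h2
  rw [h2]
  exact h1

/-- `Q` is the `q`-component, at the final time, of an HDNN with unit step size, started at
`q = 0`, whose `p`-component is constant along every trajectory. -/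
def IsHDNNReadout (n : ℕ) (σ : ℝ → ℝ) (Q : (Fin n → ℝ) → Fin n → ℝ) : Prop :=
  ∃ (N : ℕ) (J W : ℕ → Matrix (Fin n ⊕ Fin n) (Fin n ⊕ Fin n) ℝ)
    (b η : ℕ → ((Fin n ⊕ Fin n) → ℝ)), (∀ j < N, (J j)ᵀ = -(J j)) ∧
    ∀ ξ, ∃ q : ℕ → (Fin n → ℝ),
      IsHDNNTraj n N 1 σ J W b η (fun _ => ξ) q ∧ q 0 = 0 ∧ q N = Q ξ

namespace IsHDNNReadout

variable {n : ℕ} {σ : ℝ → ℝ} {Q : (Fin n → ℝ) → Fin n → ℝ}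

theorem zero : IsHDNNReadout n σ 0 :=
  ⟨0, 0, 0, 0, 0, by simp, fun _ => ⟨0, by simp [IsHDNNTraj], rfl, rfl⟩⟩

theorem add_layer (hQ : IsHDNNReadout n σ Q) (X A : Matrix (Fin n) (Fin n) ℝ)
    (c d : Fin n → ℝ) :
    IsHDNNReadout n σ (Q + fun ξ => X *ᵥ (Aᵀ *ᵥ entApp σ (A *ᵥ ξ + c) + d)) := by
  obtain ⟨N, J, W, b, η, hJ, h⟩ := hQ
  refine ⟨N + 1, Function.update J N (fromBlocks 0 (-Xᵀ) X 0),
    Function.update W N (fromBlocks A 0 0 0), Function.update b N (Sum.elim c 0),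
    Function.update η N (Sum.elim d 0), fun j hj => ?_, fun ξ => ?_⟩
  · rcases Nat.lt_succ_iff_lt_or_eq.1 hj with hj | rfl
    · simpa [hj.ne] using hJ j hj
    · simp [fromBlocks_transpose, fromBlocks_neg]
  · obtain ⟨q, hq, hq0, hqN⟩ := h ξ
    refine ⟨Function.update q (N + 1)
      (Q ξ + X *ᵥ (Aᵀ *ᵥ entApp σ (A *ᵥ ξ + c) + d)), fun j hj => ?_, by simpa, by simp⟩
    rcases Nat.lt_succ_iff_lt_or_eq.1 hj with hj | rfl
    · simpa [hj.ne, (hj.trans (Nat.lt_succ_self N)).ne] using hq j hj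
    · have hl (v w : Fin n → ℝ) : entApp σ (Sum.elim v w) ∘ Sum.inl = entApp σ v := rfl
      ext (i | i) <;>
      simp [fromBlocks_transpose, fromBlocks_mulVec, hqN, hl, ← Sum.elim_add_add]

theorem add_neuron (hQ : IsHDNNReadout n σ Q) (c w : Fin n → ℝ) (β : ℝ) :
    IsHDNNReadout n σ (Q + fun ξ => σ (w ⬝ᵥ ξ + β) • c) := by
  by_cases hw : w = 0
  · convert hQ.add_layer 1 0 0 (σ β • c) using 3 with ξ
    simp [hw]
  · obtain ⟨i, -⟩ := Function.ne_iff.1 hw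
    have hw' : w ⬝ᵥ w ≠ 0 := by simpa using hw
    convert hQ.add_layer (vecMulVec c ((w ⬝ᵥ w)⁻¹ • w)) (vecMulVec (Pi.single i 1) w)
      (fun _ => β) 0 using 3 with ξ
    simp [transpose_vecMulVec, vecMulVec_mulVec, entApp, hw', smul_mulVec, mulVec_smul, smul_smul,
      mul_comm]

theorem of_mem_span {Q' : (Fin n → ℝ) → Fin n → ℝ}
    (hQ' : Q' ∈ Submodule.span ℝ (Set.range
      fun (cwb : (Fin n → ℝ) × (Fin n → ℝ) × ℝ) ξ => σ (cwb.2.1 ⬝ᵥ ξ + cwb.2.2) • cwb.1)) :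
    IsHDNNReadout n σ Q' := by
  suffices h : ∀ Q, IsHDNNReadout n σ Q → IsHDNNReadout n σ (Q + Q') by
    simpa using h 0 zero
  induction hQ' using Submodule.closure_induction with
  | zero => simp
  | add x y _ _ hx hy => exact fun Q hQ => add_assoc Q x y ▸ hy _ (hx Q hQ)
  | smul_mem a x hx =>
    obtain ⟨⟨c, w, β⟩, rfl⟩ := hx
    intro Q hQ
    convert hQ.add_neuron (a • c) w β using 3 with ξ
    simp [smul_comm a]

end IsHDNNReadout

theorem euclNorm_le_sum_abs {m : Type*} [Fintype m] (v : m → ℝ) : euclNorm v ≤ ∑ i, |v i| := by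
  refine Real.sqrt_le_iff.2 ⟨by positivity, ?_⟩
  simpa using Finset.sum_sq_le_sq_sum_of_nonneg (s := Finset.univ) fun i _ => abs_nonneg (v i)

theorem Matrix.exists_transpose_mul_eq_one {n r : ℕ} {W : Matrix (Fin n) (Fin r) ℝ}
    (hW : W.rank = r) : ∃ R : Matrix (Fin n) (Fin r) ℝ, Wᵀ * R = 1 := by
  rw [← mulVec_surjective_iff_exists_right_inverse]
  change Function.Surjective Wᵀ.mulVecLin
  refine LinearMap.range_eq_top.1 (Submodule.eq_top_of_finrank_eq ?_)
  rw [Module.finrank_fin_fun]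
  exact (rank_transpose W).trans hW

/-- UAP of the HDNN restricted flow composed with a full-rank affine readout
`φ ↦ W_oᵀ φ + b_o : ℝⁿ → ℝʳ`, `r ≤ n`. -/
theorem hdnn_affine_readout_UAP {n r : ℕ} (σ : ℝ → ℝ)
    (hσLip : ∃ K : NNReal, LipschitzWith K σ)
    (hσpoly : ¬ ∃ P : Polynomial ℝ, ∀ x : ℝ, σ x = P.eval x)
    (Ω : Set (Fin n → ℝ)) (hΩ : IsCompact Ω)
    (hrn : r ≤ n)
    (Wo : Matrix (Fin n) (Fin r) ℝ) (hWo : Wo.rank = r) (bo : Fin r → ℝ)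
    (f : (Fin n → ℝ) → (Fin r → ℝ)) (hf : ContinuousOn f Ω)
    (ε : ℝ) (hε : 0 < ε) :
    ∃ (N : ℕ) (h : ℝ) (J W : ℕ → Matrix (Fin n ⊕ Fin n) (Fin n ⊕ Fin n) ℝ)
      (b η : ℕ → ((Fin n ⊕ Fin n) → ℝ)) (Q : (Fin n → ℝ) → (Fin n → ℝ)),
      0 < h ∧
      (∀ j < N, (J j)ᵀ = -(J j)) ∧
      (∀ ξ ∈ Ω, ∃ p q : ℕ → (Fin n → ℝ),
        IsHDNNTraj n N h σ J W b η p q ∧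
        p 0 = ξ ∧ q 0 = (fun _ => 0) ∧ q N = Q ξ) ∧
      (∀ ξ ∈ Ω, euclNorm (f ξ - (Woᵀ.mulVec (Q ξ) + bo)) ≤ ε) := by
  obtain ⟨K, hK⟩ := hσLip
  obtain ⟨R, hR⟩ := exists_transpose_mul_eq_one hWo
  have hfi (i : Fin r) : ContinuousOn (fun ξ => f ξ i - bo i) Ω := by fun_prop
  choose G hG hfG using fun i => exists_mem_span_ridge_approx hK.continuous hσpoly hΩ (hfi i)
    (show 0 < ε / (r + 1) by positivity)
  let Q : (Fin n → ℝ) → Fin n → ℝ := fun ξ => R *ᵥ fun i => G i ξ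
  have hQ : IsHDNNReadout n σ Q := by
    refine IsHDNNReadout.of_mem_span ?_
    have hQsum : Q = ∑ i, fun ξ => G i ξ • R.col i := by
      ext ξ k
      simp [Q, mulVec, dotProduct, mul_comm]
    rw [hQsum]
    refine Submodule.sum_mem _ fun i _ => ?_
    let T : ((Fin n → ℝ) → ℝ) →ₗ[ℝ] (Fin n → ℝ) → Fin n → ℝ :=
      (LinearMap.toSpanSingleton ℝ _ (R.col i)).compLeft _
    change T (G i) ∈ _
    rw [← Submodule.mem_comap]
    refine Submodule.span_le.2 ?_ (hG i)
    rintro _ ⟨⟨w, β⟩, rfl⟩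
    exact Submodule.subset_span ⟨(R.col i, w, β), rfl⟩
  obtain ⟨N, J, W, b, η, hJ, h⟩ := hQ
  refine ⟨N, 1, J, W, b, η, Q, one_pos, hJ, fun ξ _ => ?_, fun ξ hξ => ?_⟩
  · obtain ⟨q, hq, hq0, hqN⟩ := h ξ
    exact ⟨fun _ => ξ, q, hq, rfl, hq0, hqN⟩
  · refine (euclNorm_le_sum_abs _).trans ?_
    calc ∑ i, |(f ξ - (Woᵀ *ᵥ Q ξ + bo)) i| ≤ ∑ _i : Fin r, ε / (r + 1) := by
          refine Finset.sum_le_sum fun i _ => le_of_lt ?_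
          have hi : (f ξ - (Woᵀ *ᵥ Q ξ + bo)) i = f ξ i - bo i - G i ξ := by
            simp only [Q, mulVec_mulVec, hR, one_mulVec, Pi.sub_apply, Pi.add_apply]
            ring
          exact hi ▸ hfG i ξ hξ
      _ = r / (r + 1) * ε := by simp; ring
      _ ≤ ε := mul_le_of_le_one_left hε.le (div_le_one_of_le₀ (by linarith) (by positivity))
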